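/- Let G be a finite quasi-simple group (i.e., G is perfect and S := G/Z(G) is simple) with cyclic center, let e := |Z(G)|, and let χ be a faithful irreducible character of G. Then there exists a nontrivial irreducible character β of S such that for every integer d ≥ 0 with diam M(S,β) ≤ d, one has diam M(G,χ) ≤ e·d + e − 1; that is, if for all γ₁, γ₂ ∈ Irr(S) there exists 0 ≤ j ≤ d with [β^j·γ₁, γ₂]_S ≠ 0, then for all φ, ψ ∈ Irr(G) there exists 0 ≤ k ≤ e·d + e − 1 with [χ^k·φ, ψ]_G ≠ 0. -/

import Mathlib

open scoped BigOperators

/-- The inner product `[φ,ψ]_G = (1/|G|) ∑_{g∈G} φ(g)·conj(ψ(g))` of two complex-valued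
functions on a group `G`. -/
noncomputable def charInner {G : Type} [Group G] (φ ψ : G → ℂ) : ℂ :=
  (Nat.card G : ℂ)⁻¹ * ∑ᶠ g : G, φ g * (starRingEnd ℂ) (ψ g)

/-- `χ` is the character of some finite-dimensional complex representation of `G`. -/
def IsChar (G : Type) [Group G] (χ : G → ℂ) : Prop :=
  ∃ V : FDRep ℂ G, ∀ g, V.character g = χ g

/-- `χ` is the character of some irreducible finite-dimensional complex representation of `G`. -/
def IsIrrChar (G : Type) [Group G] (χ : G → ℂ) : Prop :=
  ∃ V : FDRep ℂ G, CategoryTheory.Simple V ∧ ∀ g, V.character g = χ g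

/-- `χ` is a character of `G` afforded by a faithful (injective) representation. -/
def IsFaithfulChar (G : Type) [Group G] (χ : G → ℂ) : Prop :=
  ∃ V : FDRep ℂ G, Function.Injective (fun g => V.ρ g) ∧ ∀ g, V.character g = χ g

/-- The McKay graph `M(G, α)` has diameter at most `d`: for every ordered pair of
irreducible characters `χ₁, χ₂` there is `0 ≤ j ≤ d` with `[α^j·χ₁, χ₂]_G ≠ 0`. -/
def McKayDiamLE (G : Type) [Group G] (α : G → ℂ) (d : ℕ) : Prop :=
  ∀ χ₁ χ₂ : G → ℂ, IsIrrChar G χ₁ → IsIrrChar G χ₂ →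
    ∃ j ≤ d, charInner (α ^ j * χ₁) χ₂ ≠ 0

section CharacterTheory

variable {G : Type} [Group G]

open scoped ComplexOrder in
/-- On a finite group, complex conjugation of a character is inversion of its argument. -/
theorem Representation.conj_character [Finite G] {V : Type*} [AddCommGroup V] [Module ℂ V]
    [FiniteDimensional ℂ V] (ρ : Representation ℂ G V) (g : G) :
    starRingEnd ℂ (ρ.character g) = ρ.character g⁻¹ := by
  classical
  cases nonempty_fintype G
  let b := Module.finBasis ℂ V
  let M : G → Matrix _ _ ℂ := fun h => LinearMap.toMatrix b b (ρ h)
  have hM : ∀ h k, M (h * k) = M h * M k := fun h k => by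
    simp only [M, map_mul, LinearMap.toMatrix_mul]
  have hM1 : M 1 = 1 := by simp [M]
  have htr : ∀ h, ρ.character h = (M h).trace := fun h =>
    LinearMap.trace_eq_matrix_trace ℂ b (ρ h)
  let P := ∑ h, (M h).conjTranspose * M h
  have hP : P.PosDef := by
    refine Matrix.posDef_sum Finset.univ_nonempty fun h _ =>
      Matrix.PosDef.conjTranspose_mul_self _ (Matrix.mulVec_injective_of_isUnit ?_)
    exact IsUnit.of_mul_eq_one (M h⁻¹) (by rw [← hM, mul_inv_cancel, hM1])
  have hinv : (M g).conjTranspose * P * M g = P := by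
    simp only [P, Matrix.mul_sum, Matrix.sum_mul]
    refine Fintype.sum_equiv (Equiv.mulRight g) _ _ fun h => ?_
    simp [hM, Matrix.conjTranspose_mul, Matrix.mul_assoc]
  have hgg : M g * M g⁻¹ = 1 := by rw [← hM, mul_inv_cancel, hM1]
  have hconj : (M g).conjTranspose * P = P * M g⁻¹ := by
    calc (M g).conjTranspose * P = (M g).conjTranspose * P * (M g * M g⁻¹) := by
          rw [hgg, mul_one]
      _ = P * M g⁻¹ := by rw [← mul_assoc, hinv]
  have hdet : IsUnit P.det := (Matrix.isUnit_iff_isUnit_det _).mp hP.isUnit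
  rw [htr, htr, starRingEnd_apply, ← Matrix.trace_conjTranspose]
  calc (M g).conjTranspose.trace = ((M g).conjTranspose * P * P⁻¹).trace := by
        rw [Matrix.mul_assoc, Matrix.mul_nonsing_inv _ hdet, mul_one]
    _ = (M g⁻¹).trace := by
        rw [hconj, Matrix.trace_mul_comm, ← Matrix.mul_assoc, Matrix.nonsing_inv_mul _ hdet,
          one_mul]

theorem FDRep.conj_character [Finite G] (V : FDRep ℂ G) (g : G) :
    starRingEnd ℂ (V.character g) = V.character g⁻¹ :=
  Representation.conj_character V.ρ g

theorem charInner_eq_sum [Fintype G] (φ ψ : G → ℂ) :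
    charInner φ ψ = (Nat.card G : ℂ)⁻¹ * ∑ g, φ g * starRingEnd ℂ (ψ g) := by
  rw [charInner, finsum_eq_sum_of_fintype]

theorem charInner_add_left [Finite G] (φ₁ φ₂ ψ : G → ℂ) :
    charInner (φ₁ + φ₂) ψ = charInner φ₁ ψ + charInner φ₂ ψ := by
  cases nonempty_fintype G
  simp only [charInner_eq_sum, Pi.add_apply, add_mul, Finset.sum_add_distrib, mul_add]

theorem charInner_add_right [Finite G] (φ ψ₁ ψ₂ : G → ℂ) :
    charInner φ (ψ₁ + ψ₂) = charInner φ ψ₁ + charInner φ ψ₂ := by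
  cases nonempty_fintype G
  simp only [charInner_eq_sum, Pi.add_apply, map_add, mul_add, Finset.sum_add_distrib]

/-- The inner product of two characters is a natural number. -/
theorem IsChar.exists_charInner_eq_natCast [Finite G] {φ ψ : G → ℂ} (hφ : IsChar G φ)
    (hψ : IsChar G ψ) : ∃ n : ℕ, charInner φ ψ = n := by
  cases nonempty_fintype G
  obtain ⟨V, hV⟩ := hφ
  obtain ⟨W, hW⟩ := hψ
  have : Invertible (Nat.card G : ℂ) := invertibleOfNonzero (Nat.cast_ne_zero.mpr Nat.card_pos.ne')
  refine ⟨Module.finrank ℂ (W ⟶ V), ?_⟩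
  rw [← FDRep.scalar_product_char_eq_finrank_equivariant, charInner_eq_sum]
  simp only [← hV, ← hW, FDRep.conj_character]

/-- A finite-dimensional complex representation of a finite group is simple if and only if its
character has norm one. -/
theorem FDRep.simple_iff_charInner_eq_one [Finite G] (V : FDRep ℂ G) :
    CategoryTheory.Simple V ↔ charInner V.character V.character = 1 := by
  cases nonempty_fintype G
  have hG : (Nat.card G : ℂ) ≠ 0 := Nat.cast_ne_zero.mpr Nat.card_pos.ne'
  rw [FDRep.simple_iff_char_is_norm_one, charInner_eq_sum, inv_mul_eq_one₀ hG, eq_comm]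
  simp only [FDRep.conj_character]

theorem Representation.IsIrreducible.simple [Finite G] {V : Type} [AddCommGroup V] [Module ℂ V]
    [FiniteDimensional ℂ V] (ρ : Representation ℂ G V) (hρ : ρ.IsIrreducible) :
    CategoryTheory.Simple (FDRep.of ρ) := by
  cases nonempty_fintype G
  have : Invertible (Nat.card G : ℂ) := invertibleOfNonzero (Nat.cast_ne_zero.mpr Nat.card_pos.ne')
  rw [FDRep.simple_iff_charInner_eq_one, charInner_eq_sum]
  simp only [FDRep.conj_character]
  refine (Representation.card_inv_mul_sum_char_mul_char_eq_finrank ρ ρ).trans ?_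
  simp

theorem IsIrrChar.isChar {χ : G → ℂ} (h : IsIrrChar G χ) : IsChar G χ :=
  let ⟨V, _, hV⟩ := h
  ⟨V, hV⟩

theorem isChar_character {V : Type} [AddCommGroup V] [Module ℂ V] [FiniteDimensional ℂ V]
    (ρ : Representation ℂ G V) : IsChar G ρ.character :=
  ⟨FDRep.of ρ, fun _ => rfl⟩

theorem isChar_iff {f : G → ℂ} : IsChar G f ↔ ∃ V : FDRep ℂ G, f = Representation.character V.ρ :=
  exists_congr fun _ => ⟨fun h => funext fun g => (h g).symm, fun h g => (congrFun h g).symm⟩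

theorem IsChar.zero : IsChar G 0 := by
  convert! isChar_character (Representation.trivial ℂ G PUnit)
  ext g
  simp [Representation.character]

theorem IsChar.add {f₁ f₂ : G → ℂ} (h₁ : IsChar G f₁) (h₂ : IsChar G f₂) :
    IsChar G (f₁ + f₂) := by
  obtain ⟨V, rfl⟩ := isChar_iff.mp h₁
  obtain ⟨W, rfl⟩ := isChar_iff.mp h₂
  convert! isChar_character (Representation.prod V.ρ W.ρ)
  ext g
  exact (LinearMap.trace_prodMap' _ _).symm

theorem IsChar.mul {f₁ f₂ : G → ℂ} (h₁ : IsChar G f₁) (h₂ : IsChar G f₂) :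
    IsChar G (f₁ * f₂) := by
  obtain ⟨V, rfl⟩ := isChar_iff.mp h₁
  obtain ⟨W, rfl⟩ := isChar_iff.mp h₂
  rw [← Representation.char_tensor]
  exact isChar_character _

theorem isIrrChar_one [Finite G] : IsIrrChar G 1 := by
  cases nonempty_fintype G
  have h : (FDRep.of (Representation.trivial ℂ G ℂ)).character = 1 := by
    ext g
    simp [FDRep.character]
  refine ⟨FDRep.of (Representation.trivial ℂ G ℂ), ?_, congrFun h⟩
  rw [FDRep.simple_iff_charInner_eq_one, h, charInner_eq_sum]
  simp

theorem IsChar.one [Finite G] : IsChar G 1 := isIrrChar_one.isChar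

theorem IsChar.pow [Finite G] {f : G → ℂ} (h : IsChar G f) (n : ℕ) : IsChar G (f ^ n) := by
  induction n with
  | zero => exact pow_zero f ▸ IsChar.one
  | succ n ih => exact pow_succ f n ▸ ih.mul h

theorem IsChar.multiset_sum {s : Multiset (G → ℂ)} (h : ∀ f ∈ s, IsChar G f) :
    IsChar G s.sum :=
  Multiset.sum_induction _ s (fun _ _ => IsChar.add) IsChar.zero h

/-- If `f - b` is a character, then so is `f ^ n - b ^ n`. -/
theorem IsChar.exists_add_pow [Finite G] {b r : G → ℂ} (hb : IsChar G b) (hr : IsChar G r)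
    (n : ℕ) : ∃ r', IsChar G r' ∧ (b + r) ^ n = b ^ n + r' := by
  induction n with
  | zero => exact ⟨0, .zero, by simp⟩
  | succ n ih =>
    obtain ⟨r', hr', h⟩ := ih
    refine ⟨b ^ n * r + r' * (b + r), ((hb.pow n).mul hr).add (hr'.mul (hb.add hr)), ?_⟩
    rw [pow_succ, h]
    ring

theorem Representation.character_eq_add_of_isCompl {V : Type*} [AddCommGroup V] [Module ℂ V]
    [FiniteDimensional ℂ V] (ρ : Representation ℂ G V) (σ τ : Subrepresentation ρ)
    (h : IsCompl σ.toSubmodule τ.toSubmodule) :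
    ρ.character = σ.toRepresentation.character + τ.toRepresentation.character := by
  ext g
  simp only [Representation.character, Pi.add_apply]
  rw [← LinearMap.trace_prodMap',
    ← LinearMap.trace_conj' _ (Submodule.prodEquivOfIsCompl _ _ h)]
  congr 1
  ext v
  obtain ⟨⟨x, y⟩, rfl⟩ := (Submodule.prodEquivOfIsCompl _ _ h).surjective v
  simp [LinearEquiv.conj_apply, Subrepresentation.toRepresentation]

/-- Complete reducibility at the level of characters. -/
theorem Representation.exists_multiset_isIrrChar [Finite G] {V : Type} [AddCommGroup V]
    [Module ℂ V] [FiniteDimensional ℂ V] (ρ : Representation ℂ G V) :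
    ∃ s : Multiset (G → ℂ), (∀ f ∈ s, IsIrrChar G f) ∧ ρ.character = s.sum := by
  induction hn : Module.finrank ℂ V using Nat.strong_induction_on generalizing V with
  | _ n ih =>
  subst hn
  rcases subsingleton_or_nontrivial V with hV | hV
  · refine ⟨0, by simp, ?_⟩
    ext g
    simp [Representation.character, Subsingleton.elim (ρ g) 0]
  by_cases hirr : ρ.IsIrreducible
  · exact ⟨{ρ.character}, by simpa using ⟨FDRep.of ρ, hirr.simple, fun _ => rfl⟩, by simp⟩
  have : Nontrivial (Subrepresentation ρ) := by
    exact ⟨⊥, ⊤, fun h => bot_ne_top (α := Submodule ℂ V)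
      (congrArg Subrepresentation.toSubmodule h)⟩
  obtain ⟨σ, hbot, htop⟩ : ∃ σ : Subrepresentation ρ, σ ≠ ⊥ ∧ σ ≠ ⊤ := by
    by_contra! hcon
    exact hirr ⟨fun σ => or_iff_not_imp_left.mpr (hcon σ)⟩
  obtain ⟨τ, hτ⟩ := exists_isCompl σ
  have hcompl : IsCompl σ.toSubmodule τ.toSubmodule := by
    constructor
    · rw [disjoint_iff, ← Subrepresentation.toSubmodule_inf, hτ.inf_eq_bot]
      rfl
    · rw [codisjoint_iff, ← Subrepresentation.toSubmodule_sup, hτ.sup_eq_top]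
      rfl
  have hlt : ∀ σ : Subrepresentation ρ, σ ≠ ⊤ →
      Module.finrank ℂ σ.toSubmodule < Module.finrank ℂ V := by
    intro σ hσ
    refine Submodule.finrank_lt fun h => hσ ?_
    exact Subrepresentation.toSubmodule_injective h
  have hτtop : τ ≠ ⊤ := by
    rintro rfl
    exact hbot (by simpa using hτ.disjoint)
  obtain ⟨s, hs, hs'⟩ := ih _ (hlt σ htop) σ.toRepresentation rfl
  obtain ⟨t, ht, ht'⟩ := ih _ (hlt τ hτtop) τ.toRepresentation rfl
  refine ⟨s + t, fun f hf => ?_, ?_⟩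
  · rcases Multiset.mem_add.mp hf with hf | hf
    exacts [hs f hf, ht f hf]
  · rw [ρ.character_eq_add_of_isCompl σ τ hcompl, hs', ht', Multiset.sum_add]

end CharacterTheory

section CentralScalars

variable {G : Type} [Group G]

/-- `f` is the character of a representation in which `z` acts as the scalar `c`. -/
def IsCharWithScalar (z : G) (c : ℂ) (f : G → ℂ) : Prop :=
  ∃ V : FDRep ℂ G, (∀ g, V.character g = f g) ∧ V.ρ z = c • (1 : V →ₗ[ℂ] V)

theorem IsCharWithScalar.one (z : G) : IsCharWithScalar z 1 1 :=
  ⟨FDRep.of (Representation.trivial ℂ G ℂ), fun g => by simp [FDRep.character], by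
    ext; simp⟩

theorem IsCharWithScalar.mul {z : G} {c₁ c₂ : ℂ} {f₁ f₂ : G → ℂ}
    (h₁ : IsCharWithScalar z c₁ f₁) (h₂ : IsCharWithScalar z c₂ f₂) :
    IsCharWithScalar z (c₁ * c₂) (f₁ * f₂) := by
  obtain ⟨V, hV, hVz⟩ := h₁
  obtain ⟨W, hW, hWz⟩ := h₂
  refine ⟨FDRep.of (Representation.tprod V.ρ W.ρ), fun g => ?_, ?_⟩
  · rw [Pi.mul_apply, ← hV, ← hW]
    exact congrFun (Representation.char_tensor V.ρ W.ρ) g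
  · rw [FDRep.of_ρ', Representation.tprod_apply, hVz, hWz, TensorProduct.map_smul_left,
      TensorProduct.map_smul_right, smul_smul, TensorProduct.map_one]

theorem IsCharWithScalar.pow {z : G} {c : ℂ} {f : G → ℂ} (h : IsCharWithScalar z c f) (n : ℕ) :
    IsCharWithScalar z (c ^ n) (f ^ n) := by
  induction n with
  | zero => simpa using IsCharWithScalar.one z
  | succ n ih => simpa only [pow_succ] using ih.mul h

theorem IsCharWithScalar.star [Finite G] {z : G} {c : ℂ} {f : G → ℂ} (hc : c ≠ 0)
    (h : IsCharWithScalar z c f) : IsCharWithScalar z c⁻¹ (star f) := by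
  obtain ⟨V, hV, hVz⟩ := h
  have hinv : V.ρ z⁻¹ = c⁻¹ • (1 : V →ₗ[ℂ] V) := by
    have h1 : V.ρ z⁻¹ * V.ρ z = 1 := by rw [← map_mul, inv_mul_cancel, map_one]
    rw [hVz, mul_smul_comm, mul_one] at h1
    rw [← h1, inv_smul_smul₀ hc]
  refine ⟨FDRep.of (Representation.dual V.ρ), fun g => ?_, ?_⟩
  · rw [FDRep.char_dual, ← FDRep.conj_character, hV]
    rfl
  · rw [FDRep.of_ρ', Representation.dual_apply, hinv]
    ext
    simp only [Module.Dual.transpose_apply, LinearMap.comp_apply, LinearMap.smul_apply,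
      Module.End.one_apply, map_smul]
    rfl

/-- A character whose representation is trivial on a generator of the center descends to the
quotient by the center. -/
theorem IsCharWithScalar.exists_quotient_center {z : G}
    (hz : ∀ y ∈ Subgroup.center G, y ∈ Subgroup.zpowers z) {f : G → ℂ}
    (h : IsCharWithScalar z 1 f) :
    ∃ f' : G ⧸ Subgroup.center G → ℂ, IsChar (G ⧸ Subgroup.center G) f' ∧
      ∀ g : G, f' g = f g := by
  obtain ⟨V, hV, hVz⟩ := h
  rw [one_smul] at hVz
  have hker : Subgroup.center G ≤ MonoidHom.ker V.ρ := fun y hy =>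
    (Subgroup.zpowers_le (H := MonoidHom.ker V.ρ)).mpr hVz (hz y hy)
  let ρ : Representation ℂ (G ⧸ Subgroup.center G) V :=
    QuotientGroup.lift (Subgroup.center G) V.ρ hker
  exact ⟨ρ.character, isChar_character ρ, hV⟩

open CategoryTheory in
/-- Schur's lemma for central elements. -/
theorem FDRep.exists_ρ_eq_smul_of_mem_center (V : FDRep ℂ G) [Simple V] {z : G}
    (hz : z ∈ Subgroup.center G) : ∃ c : ℂ, V.ρ z = c • (1 : V →ₗ[ℂ] V) := by
  let F : V ⟶ V := ⟨Action.ρ V z, fun g => by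
    change Action.ρ V z * Action.ρ V g = Action.ρ V g * Action.ρ V z
    rw [← map_mul, ← map_mul, Subgroup.mem_center_iff.mp hz g]⟩
  obtain ⟨c, hc⟩ := endomorphism_simple_eq_smul_id ℂ F
  refine ⟨c, ?_⟩
  have := congrArg (fun f : V ⟶ V => f.hom.hom.hom) hc
  exact this.symm

theorem FDRep.nontrivial_of_simple [Finite G] (V : FDRep ℂ G) [CategoryTheory.Simple V] :
    Nontrivial V := by
  cases nonempty_fintype G
  by_contra hV
  rw [not_nontrivial_iff_subsingleton] at hV
  have h0 : ∀ g, V.character g = 0 := fun g => by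
    rw [FDRep.character, Subsingleton.elim (V.ρ g) 0, map_zero]
  have := (FDRep.simple_iff_charInner_eq_one V).mp inferInstance
  simp [charInner_eq_sum, h0] at this

theorem FDRep.pow_card_center_eq_one_of_ρ_eq_smul [Finite G] (V : FDRep ℂ G)
    [CategoryTheory.Simple V] {z : G} (hz : z ∈ Subgroup.center G) {c : ℂ}
    (hc : V.ρ z = c • (1 : V →ₗ[ℂ] V)) : c ^ Nat.card (Subgroup.center G) = 1 := by
  have := V.nontrivial_of_simple
  have h1 : (V.ρ z) ^ Nat.card (Subgroup.center G) = 1 := by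
    have : z ^ Nat.card (Subgroup.center G) = 1 :=
      congrArg Subtype.val (pow_card_eq_one' (x := (⟨z, hz⟩ : Subgroup.center G)))
    rw [← map_pow, this, map_one]
  rw [hc, smul_pow, one_pow] at h1
  obtain ⟨v, hv⟩ := exists_ne (0 : V)
  refine smul_left_injective ℂ hv ?_
  simpa using congrArg (fun f : V →ₗ[ℂ] V => f v) h1

theorem IsIrrChar.exists_isCharWithScalar [Finite G] {f : G → ℂ} (hf : IsIrrChar G f) {z : G}
    (hz : z ∈ Subgroup.center G) :
    ∃ c : ℂ, c ^ Nat.card (Subgroup.center G) = 1 ∧ IsCharWithScalar z c f := by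
  obtain ⟨V, hV, hVf⟩ := hf
  obtain ⟨c, hc⟩ := V.exists_ρ_eq_smul_of_mem_center hz
  exact ⟨c, V.pow_card_center_eq_one_of_ρ_eq_smul hz hc, V, hVf, hc⟩

theorem IsIrrChar.apply_one_ne_zero [Finite G] {f : G → ℂ} (hf : IsIrrChar G f) : f 1 ≠ 0 := by
  obtain ⟨V, hV, hVf⟩ := hf
  have := V.nontrivial_of_simple
  rw [← hVf, FDRep.char_one]
  exact Nat.cast_ne_zero.mpr Module.finrank_pos.ne'

theorem IsIrrChar.charInner_self [Finite G] {f : G → ℂ} (hf : IsIrrChar G f) :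
    charInner f f = 1 := by
  obtain ⟨V, hV, hVf⟩ := hf
  obtain rfl := funext hVf
  exact V.simple_iff_charInner_eq_one.mp hV

/-- Any representation affording an irreducible character is simple. -/
theorem IsIrrChar.simple [Finite G] {f : G → ℂ} (hf : IsIrrChar G f) {V : FDRep ℂ G}
    (hV : ∀ g, V.character g = f g) : CategoryTheory.Simple V := by
  rw [V.simple_iff_charInner_eq_one, funext hV, hf.charInner_self]

/-- A generator of the center acts on a faithful irreducible representation through a primitive
root of unity. -/
theorem IsFaithfulChar.exists_isPrimitiveRoot [Finite G] {χ : G → ℂ} (hirr : IsIrrChar G χ)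
    (hfaith : IsFaithfulChar G χ) {z : G} (hz : z ∈ Subgroup.center G)
    (hord : orderOf z = Nat.card (Subgroup.center G)) :
    ∃ c : ℂ, IsPrimitiveRoot c (Nat.card (Subgroup.center G)) ∧ IsCharWithScalar z c χ := by
  obtain ⟨V, hinj, hVχ⟩ := hfaith
  have := hirr.simple hVχ
  obtain ⟨c, hc⟩ := V.exists_ρ_eq_smul_of_mem_center hz
  refine ⟨c, ⟨V.pow_card_center_eq_one_of_ρ_eq_smul hz hc, fun k hk => ?_⟩, V, hVχ, hc⟩
  rw [← hord]
  refine orderOf_dvd_of_pow_eq_one (hinj ?_)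
  simp only [map_pow, map_one, hc, smul_pow, hk, one_pow, one_smul]

/-- If a faithful irreducible character has constant absolute value then the group is abelian. -/
theorem IsFaithfulChar.center_eq_top_of_norm_eq [Finite G] {χ : G → ℂ} (hirr : IsIrrChar G χ)
    (hfaith : IsFaithfulChar G χ) (hnorm : ∀ g, ‖χ g‖ = ‖χ 1‖) : Subgroup.center G = ⊤ := by
  cases nonempty_fintype G
  obtain ⟨V, hinj, hVχ⟩ := hfaith
  have hdim : Module.finrank ℂ V = 1 := by
    have hχ1 : χ 1 = Module.finrank ℂ V := by rw [← hVχ, FDRep.char_one]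
    have h := hirr.charInner_self
    simp only [charInner_eq_sum, Complex.mul_conj', hnorm, hχ1] at h
    rw [Finset.sum_const, Finset.card_univ, ← Nat.card_eq_fintype_card, nsmul_eq_mul,
      inv_mul_cancel_left₀ (Nat.cast_ne_zero.mpr Nat.card_pos.ne')] at h
    norm_cast at h
    simpa using h
  refine eq_top_iff.mpr fun g _ => Subgroup.mem_center_iff.mpr fun k => hinj ?_
  obtain ⟨v, hv, hspan⟩ := finrank_eq_one_iff'.mp hdim
  obtain ⟨a, ha⟩ := hspan (V.ρ g v)
  obtain ⟨b, hb⟩ := hspan (V.ρ k v)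
  ext w
  obtain ⟨c, rfl⟩ := hspan w
  simp [← ha, ← hb, smul_comm a b]

end CentralScalars

theorem charInner_comp_mk {G : Type} [Group G] [Finite G] (N : Subgroup G) [N.Normal]
    (φ ψ : G ⧸ N → ℂ) :
    charInner (fun g : G => φ g) (fun g : G => ψ g) = charInner φ ψ := by
  classical
  cases nonempty_fintype G
  have := Fintype.ofFinite N
  have hN : (Nat.card N : ℂ) ≠ 0 := Nat.cast_ne_zero.mpr Nat.card_pos.ne'
  let F : G ⧸ N → ℂ := fun x => φ x * starRingEnd ℂ (ψ x)
  have hsum : ∑ g : G, F g = Nat.card N * ∑ x, F x := by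
    rw [← Finset.sum_fiberwise _ (QuotientGroup.mk : G → G ⧸ N), Finset.mul_sum]
    refine Finset.sum_congr rfl fun x _ => ?_
    rw [Finset.sum_congr rfl (g := fun _ => F x) fun g hg => by
      rw [(Finset.mem_filter.mp hg).2], Finset.sum_const, nsmul_eq_mul]
    congr 2
    obtain ⟨g, rfl⟩ := QuotientGroup.mk_surjective x
    have hfiber : Nat.card (QuotientGroup.mk' N ⁻¹' {QuotientGroup.mk' N g}) = Nat.card N := by
      rw [Nat.card_congr ((QuotientGroup.mk' N).fiberEquivKer g), QuotientGroup.ker_mk']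
    rw [← hfiber, ← Nat.subtype_card]
    simp only [Finset.mem_filter, Finset.mem_univ, true_and]
    exact fun _ => Iff.rfl
  rw [charInner_eq_sum, charInner_eq_sum, hsum, Subgroup.card_eq_card_quotient_mul_card_subgroup N]
  push_cast
  field_simp
  rfl

/-- Two characters with constituents that are not orthogonal are not orthogonal. -/
theorem charInner_add_ne_zero {G : Type} [Group G] [Finite G] {a a' b b' : G → ℂ}
    (ha : IsChar G a) (ha' : IsChar G a') (hb : IsChar G b) (hb' : IsChar G b')
    (h : charInner a b ≠ 0) : charInner (a + a') (b + b') ≠ 0 := by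
  rw [charInner_add_left, charInner_add_right, charInner_add_right]
  obtain ⟨n₁, h₁⟩ := ha.exists_charInner_eq_natCast hb
  obtain ⟨n₂, h₂⟩ := ha.exists_charInner_eq_natCast hb'
  obtain ⟨n₃, h₃⟩ := ha'.exists_charInner_eq_natCast hb
  obtain ⟨n₄, h₄⟩ := ha'.exists_charInner_eq_natCast hb'
  rw [h₁] at h
  rw [h₁, h₂, h₃, h₄]
  norm_cast at h ⊢
  omega

theorem exists_sum_eq_add_of_mem {G : Type} [Group G] {s : Multiset (G → ℂ)}
    (hs : ∀ f ∈ s, IsIrrChar G f) {b : G → ℂ} (hb : b ∈ s) : ∃ r, IsChar G r ∧ s.sum = b + r := by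
  obtain ⟨t, rfl⟩ := Multiset.exists_cons_of_mem hb
  exact ⟨t.sum, .multiset_sum fun f hf => (hs f (Multiset.mem_cons_of_mem hf)).isChar,
    Multiset.sum_cons b t⟩

/-- A nonzero character has an irreducible constituent. -/
theorem IsChar.exists_eq_add {G : Type} [Group G] [Finite G] {f : G → ℂ} (hf : IsChar G f)
    (h0 : f ≠ 0) : ∃ b r, IsIrrChar G b ∧ IsChar G r ∧ f = b + r := by
  obtain ⟨V, rfl⟩ := isChar_iff.mp hf
  obtain ⟨s, hs, hsum⟩ := Representation.exists_multiset_isIrrChar V.ρ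
  obtain ⟨b, hb⟩ := Multiset.exists_mem_of_ne_zero (s := s) (by rintro rfl; exact h0 hsum)
  obtain ⟨r, hr, hbr⟩ := exists_sum_eq_add_of_mem hs hb
  exact ⟨b, r, hs b hb, hr, hsum.trans hbr⟩

/-- A nonconstant character has a nontrivial irreducible constituent. -/
theorem IsChar.exists_eq_add_of_not_const {G : Type} [Group G] [Finite G] {f : G → ℂ}
    (hf : IsChar G f) (hconst : ¬ ∀ g, f g = f 1) :
    ∃ b r, IsIrrChar G b ∧ b ≠ (fun _ => 1) ∧ IsChar G r ∧ f = b + r := by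
  obtain ⟨V, rfl⟩ := isChar_iff.mp hf
  obtain ⟨s, hs, hsum⟩ := Representation.exists_multiset_isIrrChar V.ρ
  obtain ⟨b, hb, hb1⟩ : ∃ b ∈ s, b ≠ fun _ => 1 := by
    by_contra! hall
    refine hconst fun g => ?_
    rw [hsum, Multiset.eq_replicate_card.mpr hall]
    simp
  obtain ⟨r, hr, hbr⟩ := exists_sum_eq_add_of_mem hs hb
  exact ⟨b, r, hs b hb, hb1, hr, hsum.trans hbr⟩

/-- **Quasi-simple groups.** Let `G` be a finite quasi-simple group with cyclic center of
order `e`, `S = G/Z(G)`, and `χ` a faithful irreducible character of `G`. Then there is a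
nontrivial irreducible character `β` of `S` such that whenever `diam M(S,β) ≤ d`, one has
`diam M(G,χ) ≤ e·d + e − 1`. -/
theorem mckay_diam_quasisimple (G : Type) [Group G] [Finite G]
    (hperfect : commutator G = ⊤)
    (hsimple : IsSimpleGroup (G ⧸ Subgroup.center G))
    (hcyclic : IsCyclic (Subgroup.center G))
    (e : ℕ) (he : Nat.card (Subgroup.center G) = e)
    (χ : G → ℂ) (hχirr : IsIrrChar G χ) (hχfaithful : IsFaithfulChar G χ) :
    ∃ β : (G ⧸ Subgroup.center G) → ℂ,
      IsIrrChar (G ⧸ Subgroup.center G) β ∧ β ≠ (fun _ => 1) ∧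
      ∀ d : ℕ, McKayDiamLE (G ⧸ Subgroup.center G) β d →
        McKayDiamLE G χ (e * d + e - 1) := by
  subst he
  set e := Nat.card (Subgroup.center G) with he
  have he0 : e ≠ 0 := Nat.card_pos.ne'
  have : NeZero e := ⟨he0⟩
  obtain ⟨⟨z, hz⟩, hgen⟩ := hcyclic.exists_generator
  have hgen' : ∀ y ∈ Subgroup.center G, y ∈ Subgroup.zpowers z := fun y hy => by
    obtain ⟨n, hn⟩ := Subgroup.mem_zpowers_iff.mp (hgen ⟨y, hy⟩)
    exact Subgroup.mem_zpowers_iff.mpr ⟨n, congrArg Subtype.val hn⟩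
  have hord : orderOf z = e := by
    rw [he, ← orderOf_eq_card_of_forall_mem_zpowers hgen, Subgroup.orderOf_mk]
  obtain ⟨c, hprim, hχc⟩ := hχfaithful.exists_isPrimitiveRoot hχirr hz hord
  obtain ⟨X, hX, hXχ⟩ := IsCharWithScalar.exists_quotient_center hgen'
    (f := χ ^ e) (hprim.pow_eq_one ▸ hχc.pow e)
  have hconst : ¬ ∀ x, X x = X 1 := fun h => by
    have hcenter : Subgroup.center G = ⊤ := by
      refine hχfaithful.center_eq_top_of_norm_eq hχirr fun g => ?_
      have hg : χ g ^ e = χ 1 ^ e :=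
        (hXχ g).symm.trans ((h g).trans (hXχ 1))
      refine (pow_left_inj₀ (norm_nonneg _) (norm_nonneg _) he0).mp ?_
      rw [← norm_pow, ← norm_pow, hg]
    exact not_subsingleton (G ⧸ Subgroup.center G) (QuotientGroup.subsingleton_iff.mpr hcenter)
  obtain ⟨β, r, hβ, hβ1, hr, hXβ⟩ := hX.exists_eq_add_of_not_const hconst
  refine ⟨β, hβ, hβ1, fun d hd φ ψ hφ hψ => ?_⟩
  obtain ⟨a, ha, hφa⟩ := hφ.exists_isCharWithScalar hz
  obtain ⟨b, hb, hψb⟩ := hψ.exists_isCharWithScalar hz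
  have ha0 : a ≠ 0 := ne_zero_pow he0 (ha.trans_ne one_ne_zero)
  have hc0 : c ≠ 0 := hprim.ne_zero he0
  obtain ⟨i, hi, hci⟩ := hprim.eq_pow_of_pow_eq_one (ξ := b * a⁻¹) (by
    rw [mul_pow, inv_pow, ha, hb, inv_one, mul_one])
  have hscalar : b * a⁻¹ * c⁻¹ ^ i = 1 := by
    rw [← hci, inv_pow, mul_inv_cancel₀ (pow_ne_zero _ hc0)]
  obtain ⟨w, hw, hwf⟩ := IsCharWithScalar.exists_quotient_center hgen'
    (hscalar ▸ (hψb.mul (hφa.star ha0)).mul ((hχc.star hc0).pow i))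
  have hw0 : w ≠ 0 := fun h => by
    have h1 := hwf 1
    simp [h, hψ.apply_one_ne_zero, hφ.apply_one_ne_zero, hχirr.apply_one_ne_zero] at h1
  obtain ⟨u, w', hu, hw', hwu⟩ := hw.exists_eq_add hw0
  obtain ⟨j, hj, hju⟩ := hd 1 u isIrrChar_one hu
  rw [mul_one] at hju
  obtain ⟨r', hr', hpow⟩ := hβ.isChar.exists_add_pow hr j
  refine ⟨e * j + i, ?_, ?_⟩
  · have := Nat.mul_le_mul_left e hj
    omega
  have hne : charInner (X ^ j) w ≠ 0 := by
    rw [hXβ, hpow, hwu]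
    exact charInner_add_ne_zero (hβ.isChar.pow j) hr' hu.isChar hw' hju
  have hwf' : ∀ g : G, w g = ψ g * starRingEnd ℂ (φ g) * starRingEnd ℂ (χ g) ^ i := hwf
  rw [← charInner_comp_mk] at hne
  convert! hne using 1
  cases nonempty_fintype G
  simp only [charInner_eq_sum, Pi.pow_apply, hXχ, hwf']
  congr 1
  refine Finset.sum_congr rfl fun g _ => ?_
  simp only [Pi.mul_apply, Pi.pow_apply, map_mul, map_pow, Complex.conj_conj]
  ring
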